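/- For every l ≥ 2 there exists a group isomorphism η_l : ℤ^{m(l)}/𝔸_{l,l−1}ℤ^{m(l−1)} → ℤ^{m(l)}/ℍ_{l,l−1}ℤ^{m(l−1)} such that for every l ≥ 2 the square commutes: η_{l+1} ∘ Ī^t_{l,l+1} = Î^t_{l,l+1} ∘ η_l, where Ī^t_{l,l+1} and Î^t_{l,l+1} are the homomorphisms between the respective quotients induced by the matrix I_{l,l+1}^t (these induced maps are well defined). Consequently the inductive limit of the system {ℤ^{m(l)}/𝔸_{l,l−1}ℤ^{m(l−1)}, Ī^t_{l,l+1}} is isomorphic to the inductive limit of {ℤ^{m(l)}/ℍ_{l,l−1}ℤ^{m(l−1)}, Î^t_{l,l+1}}. -/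

import Mathlib

noncomputable section



open Finset

/-- Admissibility for the golden-mean (Fibonacci) shift: words over the alphabet
`{1,2}` (coded as `Fin 2`, where `0` codes the letter `1` and `1` codes the letter `2`)
with no two consecutive letters equal to `2`. -/
def DyckAdm (l : ℕ) (w : Fin l → Fin 2) : Prop :=
  ∀ i j : Fin l, (j : ℕ) = (i : ℕ) + 1 → ¬(w i = 1 ∧ w j = 1)

instance (l : ℕ) : DecidablePred (DyckAdm l) := fun w => by
  unfold DyckAdm; infer_instance

/-- The set `W_l` of admissible words of length `l`. -/
def Wset (l : ℕ) : Finset (Fin l → Fin 2) := univ.filter (DyckAdm l)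

/-- `m(l)`, the number of admissible words of length `l`. -/
def mW (l : ℕ) : ℕ := (Wset l).card

/-- Lexicographic (from the left) strict order on words. -/
def lexLt (l : ℕ) (u w : Fin l → Fin 2) : Prop :=
  ∃ i : Fin l, (∀ j : Fin l, j < i → u j = w j) ∧ u i < w i

instance (l : ℕ) : DecidableRel (lexLt l) := fun u w => by
  unfold lexLt; infer_instance

/-- The (1-based) position of an admissible word in the lexicographic ordering of `W_l`,
identifying `W_l` with `{1, …, m(l)}`. -/
def rankW (l : ℕ) (w : Fin l → Fin 2) : ℕ :=
  1 + ((Wset l).filter (fun u => lexLt l u w)).card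

/-- The matrix `I_{l,l+1}` (1-based indices, entries outside `{1,…,m(l)} × {1,…,m(l+1)}`
are `0`): `I_{l,l+1}(w,w') = 1` iff the word `w'` with its last letter deleted is `w`. -/
def Imat (l : ℕ) : ℕ → ℕ → ℤ := fun i j =>
  if ∃ w ∈ Wset l, ∃ w' ∈ Wset (l + 1),
      rankW l w = i ∧ rankW (l + 1) w' = j ∧ (∀ k : Fin l, w k = w' k.castSucc)
  then 1 else 0

/-- The matrix `M_{l,l+1}` (1-based indices):
`M_{l,l+1}(w,w') = |{k ∈ {1,2} : w' = k·w}| + ε(w,w')`, where `ε(w,w') = 1` iff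
`F(w_1,w'_1) = 1` and `(w_2,…,w_l) = (w'_1,…,w'_{l-1})`; `M_{0,1} = [3 2]`.
(Here `F(a,b) = 0` iff both letters are `2`, i.e. both codes are `1`.) -/
def Mmat : ℕ → ℕ → ℕ → ℤ
  | 0, i, j => if i = 1 ∧ j = 1 then 3 else if i = 1 ∧ j = 2 then 2 else 0
  | (l + 1), i, j =>
      ∑ w ∈ Wset (l + 1), ∑ w' ∈ Wset (l + 2),
        if rankW (l + 1) w = i ∧ rankW (l + 2) w' = j then
          ((if (∀ t : Fin (l + 1), w' t.succ = w t) then (1 : ℤ) else 0) +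
           (if (¬(w 0 = 1 ∧ w' 0 = 1)) ∧
               (∀ t : Fin (l + 1), (t : ℕ) ≠ 0 →
                 w t = w' ⟨(t : ℕ) - 1,
                   (Nat.sub_le _ _).trans_lt (t.isLt.trans (Nat.lt_succ_self _))⟩)
            then (1 : ℤ) else 0))
        else 0

/-- The matrices `S_l` (of size `m(l-1) × m(l+1)`, 1-based indices):
`S_0 = [1 1]`, `S_1 = [1 1 1]`, `S_{l+2} = [[S_{l+1}, 0], [0, S_l]]` (block diagonal). -/
def Smat : ℕ → ℕ → ℕ → ℤ
  | 0, i, j => if i = 1 ∧ (1 ≤ j ∧ j ≤ 2) then 1 else 0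
  | 1, i, j => if i = 1 ∧ (1 ≤ j ∧ j ≤ 3) then 1 else 0
  | (l + 2), i, j =>
      if i ≤ mW l then (if j ≤ mW (l + 2) then Smat (l + 1) i j else 0)
      else (if j ≤ mW (l + 2) then 0 else Smat l (i - mW l) (j - mW (l + 2)))

/-- The matrix `𝔸_{l+1,l} = M_{l,l+1}^t − I_{l,l+1}^t` (1-based indices). -/
def AmatN (l : ℕ) : ℕ → ℕ → ℤ := fun i j => Mmat l j i - Imat l j i

/-- `𝔸_{l+1,l} = M_{l,l+1}^t − I_{l,l+1}^t` as an `m(l+1) × m(l)` matrix over `Fin` types. -/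
def AMat (l : ℕ) : Matrix (Fin (mW (l + 1))) (Fin (mW l)) ℤ :=
  fun i j => AmatN l ((i : ℕ) + 1) ((j : ℕ) + 1)

/-- The vectors `v_l ∈ ℤ^{m(l-1)}` (1-based entries): `v_1 = (-3)`, `v_2 = (-3,-3)`;
for `l ≥ 3`, `v_l(i) = -3` if `l ≡ 1, 2 (mod 4)` and `v_l(i) = 3` if `l ≡ 3, 0 (mod 4)`
for `1 ≤ i ≤ m(l-2)`, and `v_l(m(l-2)+i) = v_{l-2}(i) ∓ 4` (sign so as to decrease the
absolute value) for `1 ≤ i ≤ m(l-3)`. -/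
def vv : ℕ → ℕ → ℤ
  | 0, _ => 0
  | 1, i => if i = 1 then -3 else 0
  | 2, i => if 1 ≤ i ∧ i ≤ 2 then -3 else 0
  | (l + 3), i =>
      if 1 ≤ i ∧ i ≤ mW (l + 1) then
        (if (l + 3) % 4 = 1 ∨ (l + 3) % 4 = 2 then -3 else 3)
      else if mW (l + 1) < i ∧ i ≤ mW (l + 1) + mW l then
        (if 0 < vv (l + 1) (i - mW (l + 1)) then vv (l + 1) (i - mW (l + 1)) - 4
         else vv (l + 1) (i - mW (l + 1)) + 4)
      else 0

/-- The matrix `𝒩_{l+1,l}` (1-based indices, size `m(l+1) × m(l)`). -/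
def Nmat (l : ℕ) : ℕ → ℕ → ℤ := fun i j =>
  if 1 ≤ j ∧ j ≤ mW l ∧ 1 ≤ i ∧ i ≤ mW (l + 1) then
    (if i = j ∧ i < mW l then 1
     else if i = j ∧ i = mW l then 2
     else if mW l < i ∧ j = mW l then vv l (i - mW l)
     else 0)
  else 0

/-- The matrix `ℍ_{l+1,l}` (1-based indices, size `m(l+1) × m(l)`). -/
def Hmat (l : ℕ) : ℕ → ℕ → ℤ := fun i j =>
  if 1 ≤ j ∧ j ≤ mW l ∧ 1 ≤ i ∧ i ≤ mW (l + 1) then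
    (if i = j ∧ i < mW l then 1
     else if i = j ∧ i = mW l then 2
     else if mW l < i ∧ j = mW l then -1
     else 0)
  else 0

/-- `ℍ_{l+1,l}` as an additive map `ℤ^{m(l)} → ℤ^{m(l+1)}`. -/
def Hadd (l : ℕ) : (Fin (mW l) → ℤ) →+ (Fin (mW (l + 1)) → ℤ) :=
  (Matrix.mulVecLin
    (fun (i : Fin (mW (l + 1))) (j : Fin (mW l)) => Hmat l ((i : ℕ) + 1) ((j : ℕ) + 1))).toAddMonoidHom

/-- The vector `R_n = (2, -1, …, -1) ∈ ℤ^{n+1}`. -/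
def Rvec (n : ℕ) : Fin (n + 1) → ℤ := fun i => if i = 0 then 2 else -1

/-- `𝔸_{l+1,l} = M_{l,l+1}^t − I_{l,l+1}^t` as an additive map `ℤ^{m(l)} → ℤ^{m(l+1)}`. -/
def Aadd (l : ℕ) : (Fin (mW l) → ℤ) →+ (Fin (mW (l + 1)) → ℤ) :=
  (AMat l).mulVecLin.toAddMonoidHom

/-- `I_{l,l+1}^t` as an additive map `ℤ^{m(l)} → ℤ^{m(l+1)}`. -/
def ITadd (l : ℕ) : (Fin (mW l) → ℤ) →+ (Fin (mW (l + 1)) → ℤ) :=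
  (Matrix.mulVecLin
    (fun (i : Fin (mW (l + 1))) (j : Fin (mW l)) => Imat l ((j : ℕ) + 1) ((i : ℕ) + 1))).toAddMonoidHom

/-- `ITreach a b x y` holds iff `y` is obtained from `x` by applying the maps
`I^t_{a,a+1}, I^t_{a+1,a+2}, …, I^t_{b-1,b}` successively (`y = x` if `b = a`). -/
inductive ITreach : ∀ (a b : ℕ), (Fin (mW a) → ℤ) → (Fin (mW b) → ℤ) → Prop
  | refl (a : ℕ) (x : Fin (mW a) → ℤ) : ITreach a a x x
  | step {a b : ℕ} {x : Fin (mW a) → ℤ} {y : Fin (mW b) → ℤ} :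
      ITreach a b x y → ITreach a (b + 1) x (ITadd b y)

/-! ### Lexicographic ranks -/

theorem lexLt_iff_toLex_lt {l : ℕ} {u w : Fin l → Fin 2} :
    lexLt l u w ↔ toLex u < toLex w := Iff.rfl

theorem not_lexLt_self {l : ℕ} (w : Fin l → Fin 2) : ¬lexLt l w w := lt_irrefl (toLex w)

theorem mem_Wset {l : ℕ} {w : Fin l → Fin 2} : w ∈ Wset l ↔ DyckAdm l w := by
  simp [Wset]

theorem rankW_lt_rankW {l : ℕ} {u w : Fin l → Fin 2} (hu : u ∈ Wset l) (h : lexLt l u w) :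
    rankW l u < rankW l w := by
  unfold rankW
  refine Nat.add_lt_add_left (card_lt_card ?_) 1
  rw [ssubset_iff_of_subset]
  · exact ⟨u, by simp [hu, h], by simp [not_lexLt_self]⟩
  · intro v hv
    simp only [mem_filter] at hv ⊢
    exact ⟨hv.1, lt_trans (lexLt_iff_toLex_lt.1 hv.2) h⟩

theorem rankW_injOn {l : ℕ} {u w : Fin l → Fin 2} (hu : u ∈ Wset l) (hw : w ∈ Wset l)
    (h : rankW l u = rankW l w) : u = w := by
  rcases lt_trichotomy (toLex u) (toLex w) with h' | h' | h'
  · exact absurd h (rankW_lt_rankW hu h').ne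
  · exact h'
  · exact absurd h (rankW_lt_rankW hw h').ne'

theorem one_le_rankW (l : ℕ) (w : Fin l → Fin 2) : 1 ≤ rankW l w := Nat.le_add_right _ _

theorem rankW_le {l : ℕ} {w : Fin l → Fin 2} (hw : w ∈ Wset l) : rankW l w ≤ mW l := by
  have : ((Wset l).filter (fun u => lexLt l u w)).card < (Wset l).card := by
    refine card_lt_card ?_
    rw [ssubset_iff_of_subset (filter_subset _ _)]
    exact ⟨w, hw, by simp [not_lexLt_self]⟩
  unfold rankW mW
  omega

/-- The number of admissible words of length `l + 1` with first letter `1`. -/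
theorem card_filter_head_eq_zero (l : ℕ) :
    ((Wset (l + 1)).filter (fun w => w 0 = 0)).card = mW l := by
  symm
  refine card_bij (fun w _ => Fin.cons 0 w) ?_ ?_ ?_
  · intro w hw
    rw [mem_Wset] at hw
    simp only [mem_filter, mem_Wset, Fin.cons_zero, and_true]
    intro i j hij
    cases i using Fin.cases with
    | zero => simp
    | succ i =>
      cases j using Fin.cases with
      | zero => simp
      | succ j =>
        simp only [Fin.cons_succ]
        exact hw i j (by simpa using hij)
  · intro u _ w _ h
    exact Fin.cons_right_injective _ h
  · intro w hw
    simp only [mem_filter, mem_Wset] at hw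
    refine ⟨Fin.tail w, ?_, ?_⟩
    · rw [mem_Wset]
      intro i j hij
      exact hw.1 i.succ j.succ (by simpa using hij)
    · rw [← hw.2, Fin.cons_self_tail]

theorem rankW_le_iff {l : ℕ} {w : Fin (l + 1) → Fin 2} (hw : w ∈ Wset (l + 1)) :
    rankW (l + 1) w ≤ mW l ↔ w 0 = 0 := by
  rw [← card_filter_head_eq_zero l, rankW]
  constructor
  · intro h
    by_contra h0
    have : ((Wset (l + 1)).filter (fun w => w 0 = 0)).card ≤
        ((Wset (l + 1)).filter (fun u => lexLt (l + 1) u w)).card := by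
      refine card_le_card ?_
      intro u hu
      simp only [mem_filter] at hu ⊢
      refine ⟨hu.1, 0, fun j hj => absurd hj (by simp), ?_⟩
      rw [hu.2]
      exact Fin.pos_iff_ne_zero.2 h0
    omega
  · intro h0
    have : ((Wset (l + 1)).filter (fun u => lexLt (l + 1) u w)).card <
        ((Wset (l + 1)).filter (fun w => w 0 = 0)).card := by
      refine card_lt_card ?_
      rw [ssubset_iff_of_subset]
      · exact ⟨w, by simp [hw, h0], by simp [not_lexLt_self]⟩
      · intro u hu
        simp only [mem_filter] at hu ⊢
        refine ⟨hu.1, ?_⟩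
        obtain ⟨i, hi, hlt⟩ := hu.2
        rcases eq_or_ne i 0 with rfl | hne
        · rw [h0] at hlt
          exact absurd hlt (by simp)
        · rw [hi 0 (Fin.pos_iff_ne_zero.2 hne), h0]
    omega

/-! ### One-sided sequences of the golden-mean shift -/

/-- The one-sided golden-mean shift space (`1 : Fin 2` codes the letter `2`). -/
abbrev GoldenSeq : Type := {s : ℕ → Fin 2 // ∀ i, ¬(s i = 1 ∧ s (i + 1) = 1)}

namespace GoldenSeq

/-- The prefix of length `l`. -/
def word (l : ℕ) (s : GoldenSeq) : Fin l → Fin 2 := fun i => s.1 i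

theorem word_mem (l : ℕ) (s : GoldenSeq) : word l s ∈ Wset l := by
  rw [mem_Wset]
  intro i j hij
  simp only [word, hij]
  exact s.2 i

theorem exists_word_eq {l : ℕ} {w : Fin l → Fin 2} (hw : w ∈ Wset l) :
    ∃ s : GoldenSeq, word l s = w := by
  rw [mem_Wset] at hw
  refine ⟨⟨fun i => if h : i < l then w ⟨i, h⟩ else 0, fun i => ?_⟩, ?_⟩
  · by_cases h : i + 1 < l
    · simp only [h, show i < l by omega, dif_pos]
      exact hw _ _ rfl
    · simp [h]
  · funext i
    simp [word]

/-- The shift. -/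
def shift (s : GoldenSeq) : GoldenSeq := ⟨fun i => s.1 (i + 1), fun i => s.2 (i + 1)⟩

/-- Prefixing an allowed letter. -/
def cons (a : Fin 2) (s : GoldenSeq) (h : ¬(a = 1 ∧ s.1 0 = 1)) : GoldenSeq :=
  ⟨fun i => Nat.casesOn i a s.1, fun i => by
    cases i with
    | zero => exact h
    | succ i => exact s.2 i⟩

/-- Prefixing the letter `1`. -/
def consZero (s : GoldenSeq) : GoldenSeq := cons 0 s (by simp)

@[simp] theorem consZero_zero (s : GoldenSeq) : (consZero s).1 0 = 0 := rfl

@[simp] theorem shift_consZero (s : GoldenSeq) : shift (consZero s) = s := rfl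

theorem consZero_shift {s : GoldenSeq} (h : s.1 0 = 0) : consZero (shift s) = s := by
  apply Subtype.ext
  funext i
  cases i with
  | zero => exact h.symm
  | succ i => rfl

/-- The sequence `1 2 1 2 …`. -/
def alternating : GoldenSeq :=
  ⟨fun i => if Even i then 0 else 1, fun i => by
    by_cases h : Even i <;> simp [h, Nat.even_add_one]⟩

theorem alternating_zero : alternating.1 0 = 0 := rfl

/-- The zero-based position of the prefix of length `l` in the lexicographic order. -/
def pos (l : ℕ) (s : GoldenSeq) : Fin (mW l) :=
  ⟨rankW l (word l s) - 1, by
    have := one_le_rankW l (word l s)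
    have := rankW_le (word_mem l s)
    omega⟩

theorem pos_val_add_one (l : ℕ) (s : GoldenSeq) : (pos l s : ℕ) + 1 = rankW l (word l s) :=
  Nat.sub_add_cancel (one_le_rankW _ _)

theorem rankW_eq_pos_add_one {l : ℕ} {w : Fin l → Fin 2} (hw : w ∈ Wset l) (s : GoldenSeq) :
    rankW l w = (pos l s : ℕ) + 1 ↔ w = word l s := by
  rw [pos_val_add_one]
  exact ⟨rankW_injOn hw (word_mem l s), fun h => h ▸ rfl⟩

theorem pos_eq_iff {l : ℕ} {s t : GoldenSeq} :
    pos l s = pos l t ↔ ∀ i < l, s.1 i = t.1 i := by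
  rw [Fin.ext_iff, ← Nat.add_right_cancel_iff (n := 1), pos_val_add_one,
    rankW_eq_pos_add_one (word_mem l s), funext_iff, Fin.forall_iff]
  rfl

theorem pos_surjective (l : ℕ) : Function.Surjective (pos l) := by
  let f : Wset l → Fin (mW l) := fun w => pos l (exists_word_eq w.2).choose
  have hf : Function.Injective f := by
    intro u w h
    have h1 := (exists_word_eq u.2).choose_spec
    have h2 := (exists_word_eq w.2).choose_spec
    have h3 := pos_eq_iff.1 h
    apply Subtype.ext
    rw [← h1, ← h2]
    funext i
    exact h3 i i.2
  have hb : Function.Bijective f := by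
    rw [Fintype.bijective_iff_injective_and_card]
    exact ⟨hf, by rw [Fintype.card_coe, Fintype.card_fin, mW]⟩
  intro i
  obtain ⟨w, hw⟩ := hb.2 i
  exact ⟨_, hw⟩

theorem pos_lt_iff {l : ℕ} {s : GoldenSeq} : (pos (l + 1) s : ℕ) < mW l ↔ s.1 0 = 0 := by
  rw [← Nat.add_one_le_iff, pos_val_add_one, rankW_le_iff (word_mem _ s)]
  rfl

theorem lexLt_word_alternating {l : ℕ} {s : GoldenSeq} (h0 : s.1 0 = 0)
    (hne : word l s ≠ word l alternating) : lexLt l (word l s) (word l alternating) := by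
  rw [lexLt_iff_toLex_lt]
  refine lt_of_le_of_ne (le_of_not_gt ?_) hne
  rintro ⟨i, hi, hlt⟩
  have hi0 : alternating.1 i = 0 ∧ s.1 i = 1 := by
    change alternating.1 i < s.1 i at hlt
    omega
  obtain ⟨i, hil⟩ := i
  cases i with
  | zero => simp [h0] at hi0
  | succ i =>
    have h1 : alternating.1 i = s.1 i := hi ⟨i, by omega⟩ (Fin.mk_lt_mk.2 (by omega))
    have h2 := s.2 i
    have h3 : alternating.1 i = 1 := by
      have := hi0.1
      simp only [alternating, Nat.even_add_one] at this ⊢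
      by_cases h : Even i <;> simp_all
    exact h2 ⟨h1 ▸ h3, hi0.2⟩

theorem mW_pos (l : ℕ) : 0 < mW l := Fin.pos (pos l alternating)

theorem mW_le_succ (l : ℕ) : mW l ≤ mW (l + 1) := by
  rw [← card_filter_head_eq_zero l]
  exact card_le_card (filter_subset _ _)

theorem pos_alternating (l : ℕ) : (pos (l + 1) alternating : ℕ) = mW l - 1 := by
  have hlt : (pos (l + 1) alternating : ℕ) < mW l := pos_lt_iff.2 alternating_zero
  have hl := mW_le_succ l
  obtain ⟨s, hs⟩ := pos_surjective (l + 1) ⟨mW l - 1, by omega⟩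
  have hs' : (pos (l + 1) s : ℕ) = mW l - 1 := by rw [hs]
  have h0 : s.1 0 = 0 := (pos_lt_iff (l := l)).1 (by omega)
  by_cases h : word (l + 1) s = word (l + 1) alternating
  · simp only [← hs', pos, h]
  · have := rankW_lt_rankW (word_mem _ s) (lexLt_word_alternating h0 h)
    rw [← pos_val_add_one, ← pos_val_add_one] at this
    omega

/-! ### Functions of finitely many coordinates -/

/-- `g` depends only on the first `l` letters. -/
def DependsOnPrefix (l : ℕ) (g : GoldenSeq → ℤ) : Prop :=
  ∀ s t : GoldenSeq, (∀ i < l, s.1 i = t.1 i) → g s = g t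

theorem DependsOnPrefix.mono {k l : ℕ} {g : GoldenSeq → ℤ} (h : DependsOnPrefix k g)
    (hkl : k ≤ l) : DependsOnPrefix l g :=
  fun s t hst => h s t fun i hi => hst i (hi.trans_le hkl)

theorem DependsOnPrefix.add {l : ℕ} {g h : GoldenSeq → ℤ} (hg : DependsOnPrefix l g)
    (hh : DependsOnPrefix l h) : DependsOnPrefix l (g + h) :=
  fun s t hst => by simp only [Pi.add_apply, hg s t hst, hh s t hst]

/-- The function on sequences given by a vector indexed by the words of length `l`. -/
def lift (l : ℕ) : (Fin (mW l) → ℤ) →+ (GoldenSeq → ℤ) where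
  toFun x s := x (pos l s)
  map_zero' := rfl
  map_add' _ _ := rfl

@[simp] theorem lift_apply (l : ℕ) (x : Fin (mW l) → ℤ) (s : GoldenSeq) :
    lift l x s = x (pos l s) := rfl

theorem lift_injective (l : ℕ) : Function.Injective (lift l) := by
  intro x y h
  funext i
  obtain ⟨s, rfl⟩ := pos_surjective l i
  exact congrFun h s

theorem dependsOnPrefix_lift (l : ℕ) (x : Fin (mW l) → ℤ) : DependsOnPrefix l (lift l x) :=
  fun _ _ h => congrArg x (pos_eq_iff.2 h)

theorem exists_lift_eq {l : ℕ} {g : GoldenSeq → ℤ} (hg : DependsOnPrefix l g) :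
    ∃ x, lift l x = g := by
  refine ⟨fun i => g (pos_surjective l i).choose, ?_⟩
  funext s
  exact hg _ _ (pos_eq_iff.1 (pos_surjective l (pos l s)).choose_spec)

/-- The transfer operator `g ↦ (s ↦ ∑ₐ g (a s))`, the sum being over allowed letters `a`. -/
def transfer (g : GoldenSeq → ℤ) (s : GoldenSeq) : ℤ :=
  g (consZero s) + if h : s.1 0 = 1 then 0 else g (cons 1 s (fun h' => h h'.2))

/-- The operator on functions induced by the matrices `𝔸`. -/
def dyckOp : (GoldenSeq → ℤ) →+ (GoldenSeq → ℤ) where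
  toFun g s := g (shift s) + transfer g s - g s
  map_zero' := by
    funext s
    simp [transfer]
  map_add' g h := by
    funext s
    simp only [transfer, Pi.add_apply]
    split_ifs <;> ring

theorem dyckOp_apply (g : GoldenSeq → ℤ) (s : GoldenSeq) :
    dyckOp g s = g (shift s) + transfer g s - g s := rfl

/-- The projection along which the cokernels of `𝔸` and `ℍ` are compared. -/
def compareOp : (GoldenSeq → ℤ) →+ (GoldenSeq → ℤ) where
  toFun g s := g alternating + if s.1 0 = 1 then g s else 0
  map_zero' := by
    funext s
    simp
  map_add' g h := by
    funext s
    simp only [Pi.add_apply]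
    split_ifs <;> ring

theorem compareOp_apply (g : GoldenSeq → ℤ) (s : GoldenSeq) :
    compareOp g s = g alternating + if s.1 0 = 1 then g s else 0 := rfl

theorem DependsOnPrefix.transfer {l : ℕ} {g : GoldenSeq → ℤ} (hg : DependsOnPrefix (l + 1) g) :
    DependsOnPrefix (l + 1) (transfer g) := by
  intro s t h
  have h0 := h 0 (Nat.succ_pos l)
  unfold GoldenSeq.transfer
  rw [hg (consZero s) (consZero t)]
  · congr 1
    by_cases h1 : s.1 0 = 1
    · rw [dif_pos h1, dif_pos (h0 ▸ h1)]
    · rw [dif_neg h1, dif_neg (h0 ▸ h1)]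
      refine hg _ _ fun i hi => ?_
      cases i with
      | zero => rfl
      | succ i => exact h i (by omega)
  · intro i hi
    cases i with
    | zero => rfl
    | succ i => exact h i (by omega)

theorem DependsOnPrefix.dyckOp {l : ℕ} {g : GoldenSeq → ℤ} (hg : DependsOnPrefix (l + 1) g) :
    DependsOnPrefix (l + 2) (dyckOp g) := by
  intro s t h
  rw [dyckOp_apply, dyckOp_apply, hg.transfer s t fun i hi => h i (by omega),
    hg s t fun i hi => h i (by omega),
    hg (shift s) (shift t) fun i hi => h (i + 1) (by omega)]

theorem DependsOnPrefix.compareOp {l : ℕ} {g : GoldenSeq → ℤ} (hg : DependsOnPrefix (l + 1) g) :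
    DependsOnPrefix (l + 1) (compareOp g) := by
  intro s t h
  rw [compareOp_apply, compareOp_apply, h 0 (Nat.succ_pos l), hg s t h]

theorem transfer_consZero (g : GoldenSeq → ℤ) (s : GoldenSeq) :
    transfer g (consZero s) =
      g (consZero (consZero s)) + g (cons 1 (consZero s) (by simp)) := by
  simp [transfer]

/-- A solution of `compareOp g = dyckOp x` has `x` constant. -/
theorem dependsOnPrefix_zero_of_compareOp_eq {g x : GoldenSeq → ℤ} (h : compareOp g = dyckOp x) :
    ∀ l, DependsOnPrefix l x → DependsOnPrefix 0 x := by
  intro l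
  induction l with
  | zero => exact id
  | succ l ih =>
    intro hx
    refine ih fun s t hst => ?_
    have key : ∀ u : GoldenSeq, x u = g alternating - (x (consZero (consZero u)) +
        x (cons 1 (consZero u) (by simp))) + x (consZero u) := by
      intro u
      have := congrFun h (consZero u)
      rw [compareOp_apply, dyckOp_apply, transfer_consZero] at this
      simp only [consZero_zero, shift_consZero, zero_ne_one, if_false] at this
      linarith
    have h1 : ∀ i < l + 1, (consZero s).1 i = (consZero t).1 i := by
      intro i hi
      cases i with
      | zero => rfl
      | succ i => exact hst i (by omega)
    rw [key s, key t, hx _ _ h1, hx (consZero (consZero s)) (consZero (consZero t)),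
      hx (cons 1 (consZero s) (by simp)) (cons 1 (consZero t) (by simp))]
    · intro i hi
      cases i with
      | zero => rfl
      | succ i => exact h1 i (by omega)
    · intro i hi
      cases i with
      | zero => rfl
      | succ i => exact h1 i (by omega)

theorem eq_const_of_compareOp_eq {l : ℕ} {g x : GoldenSeq → ℤ} (hx : DependsOnPrefix l x)
    (h : compareOp g = dyckOp x) :
    ∃ c, g alternating = 2 * c ∧ ∀ s : GoldenSeq, s.1 0 = 1 → g s = -c := by
  have hc : ∀ s, x s = x alternating := fun s =>
    dependsOnPrefix_zero_of_compareOp_eq h l hx s alternating (by simp)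
  have h0 : g alternating = 2 * x alternating := by
    have := congrFun h alternating
    simp only [compareOp_apply, dyckOp_apply, transfer, hc, alternating_zero, zero_ne_one,
      if_false, dif_neg, not_false_eq_true] at this
    linarith
  refine ⟨x alternating, h0, fun s hs => ?_⟩
  have := congrFun h s
  simp only [compareOp_apply, dyckOp_apply, transfer, hc, hs, if_true, dif_pos] at this
  linarith

theorem compareOp_eq_dyckOp_const {g : GoldenSeq → ℤ} {c : ℤ} (h0 : g alternating = 2 * c)
    (h1 : ∀ s : GoldenSeq, s.1 0 = 1 → g s = -c) : compareOp g = dyckOp (fun _ => c) := by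
  funext s
  by_cases hs : s.1 0 = 1
  · simp only [compareOp_apply, dyckOp_apply, transfer, hs, if_true, dif_pos, h0, h1 s hs]
    ring
  · simp only [compareOp_apply, dyckOp_apply, transfer, hs, if_false, dif_neg, h0,
      not_false_eq_true]
    ring

theorem exists_compareOp_add_dyckOp (l : ℕ) : ∀ f : GoldenSeq → ℤ, DependsOnPrefix (l + 1) f →
    ∃ g x, DependsOnPrefix (l + 1) g ∧ DependsOnPrefix l x ∧ f = compareOp g + dyckOp x := by
  induction l with
  | zero =>
    intro f hf
    refine ⟨fun s => if s.1 0 = 1 then f s - f alternating else f alternating, 0, ?_,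
      fun _ _ _ => rfl, ?_⟩
    · intro s t h
      simp only [h 0 Nat.one_pos, hf s t h]
    · funext s
      rw [map_zero, add_zero, compareOp_apply]
      by_cases hs : s.1 0 = 1
      · simp [hs, alternating_zero]
      · have : f s = f alternating := by
          refine hf _ _ fun i hi => ?_
          obtain rfl : i = 0 := by omega
          rw [alternating_zero]
          omega
        simp [hs, alternating_zero, this]
  | succ l ih =>
    intro f hf
    set x : GoldenSeq → ℤ := fun u => f (consZero u) with hxdef
    have hx : DependsOnPrefix (l + 1) x := by
      intro s t h
      refine hf _ _ fun i hi => ?_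
      cases i with
      | zero => rfl
      | succ i => exact h i (by omega)
    have hh : DependsOnPrefix (l + 1) (x - transfer x) := by
      intro s t hst
      rw [Pi.sub_apply, Pi.sub_apply, hx s t hst, hx.transfer s t hst]
    obtain ⟨g', x', hg', hx', hf'⟩ := ih _ hh
    set k : GoldenSeq → ℤ := fun s => if s.1 0 = 1 then
      f s - dyckOp x s - (x - transfer x) s else 0 with hk
    have hkC : DependsOnPrefix (l + 2) k := by
      intro s t hst
      simp only [hk, hst 0 (by omega), hf s t hst, hx.dyckOp s t hst,
        hh.mono (Nat.le_succ _) s t hst]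
    refine ⟨g' + k, x' + x, (hg'.mono (Nat.le_succ _)).add hkC,
      (hx'.mono (Nat.le_succ _)).add hx, ?_⟩
    have hPk : compareOp k = k := by
      funext s
      rw [compareOp_apply]
      by_cases hs : s.1 0 = 1 <;> simp [hk, hs, alternating_zero]
    rw [map_add, map_add, hPk]
    have : f = k + dyckOp x + (x - transfer x) := by
      funext s
      by_cases hs : s.1 0 = 1
      · simp only [hk, hs, if_true, Pi.add_apply]
        ring
      · have hs0 : s.1 0 = 0 := by omega
        simp only [hk, hs, if_false, Pi.add_apply, Pi.sub_apply, dyckOp_apply, hxdef,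
          consZero_shift hs0]
        ring
    rw [this, hf']
    abel

/-! ### The matrices as operators on functions -/

theorem Imat_pos (l : ℕ) (r s : GoldenSeq) :
    Imat l ((pos l r : ℕ) + 1) ((pos (l + 1) s : ℕ) + 1) = if pos l s = pos l r then 1 else 0 := by
  unfold Imat
  refine if_congr ?_ rfl rfl
  rw [pos_eq_iff]
  constructor
  · rintro ⟨w, hw, w', hw', h1, h2, h3⟩ i hi
    rw [rankW_eq_pos_add_one hw] at h1
    rw [rankW_eq_pos_add_one hw'] at h2
    subst h1 h2
    exact (h3 ⟨i, hi⟩).symm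
  · intro h
    exact ⟨word l r, word_mem l r, word (l + 1) s, word_mem _ s, (pos_val_add_one _ _).symm,
      (pos_val_add_one _ _).symm, fun k => (h k k.2).symm⟩

theorem lift_ITadd (l : ℕ) (x : Fin (mW l) → ℤ) : lift (l + 1) (ITadd l x) = lift l x := by
  funext s
  have : ∀ j : Fin (mW l), Imat l ((j : ℕ) + 1) ((pos (l + 1) s : ℕ) + 1) =
      if pos l s = j then 1 else 0 := by
    intro j
    obtain ⟨r, rfl⟩ := pos_surjective l j
    exact Imat_pos l r s
  change ∑ j : Fin (mW l), Imat l ((j : ℕ) + 1) ((pos (l + 1) s : ℕ) + 1) * x j = x (pos l s)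
  simp [this]

theorem Mmat_pos (l : ℕ) (r s : GoldenSeq) :
    Mmat (l + 1) ((pos (l + 1) r : ℕ) + 1) ((pos (l + 2) s : ℕ) + 1) =
      (if pos (l + 1) (shift s) = pos (l + 1) r then 1 else 0) +
      ((if pos (l + 1) (consZero s) = pos (l + 1) r then 1 else 0) +
        if h : s.1 0 = 1 then 0 else
          if pos (l + 1) (cons 1 s (fun h' => h h'.2)) = pos (l + 1) r then 1 else 0) := by
  have hiff : ∀ w ∈ Wset (l + 1), ∀ w' ∈ Wset (l + 2),
      ((rankW (l + 1) w = (pos (l + 1) r : ℕ) + 1 ∧ rankW (l + 2) w' = (pos (l + 2) s : ℕ) + 1) ↔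
        (w = word (l + 1) r ∧ w' = word (l + 2) s)) := fun w hw w' hw' =>
    and_congr (rankW_eq_pos_add_one hw r) (rankW_eq_pos_add_one hw' s)
  rw [Mmat, sum_eq_single_of_mem _ (word_mem (l + 1) r),
    sum_eq_single_of_mem _ (word_mem (l + 2) s),
    if_pos ((hiff _ (word_mem _ r) _ (word_mem _ s)).2 ⟨rfl, rfl⟩)]
  · congr 1
    · refine if_congr ?_ rfl rfl
      rw [pos_eq_iff, Fin.forall_iff]
      rfl
    · have htail : (∀ t : Fin (l + 1), (t : ℕ) ≠ 0 → word (l + 1) r t =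
          word (l + 2) s ⟨(t : ℕ) - 1,
            (Nat.sub_le _ _).trans_lt (t.isLt.trans (Nat.lt_succ_self _))⟩) ↔
          ∀ i < l, s.1 i = r.1 (i + 1) := by
        constructor
        · intro h i hi
          exact (h ⟨i + 1, by omega⟩ (Nat.succ_ne_zero i)).symm
        · rintro h ⟨t, ht⟩ ht0
          cases t with
          | zero => exact absurd rfl ht0
          | succ t => exact (h t (by omega)).symm
      have hcons : ∀ (a : Fin 2) (ha : ¬(a = 1 ∧ s.1 0 = 1)),
          pos (l + 1) (cons a s ha) = pos (l + 1) r ↔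
            r.1 0 = a ∧ ∀ i < l, s.1 i = r.1 (i + 1) := by
        intro a ha
        rw [pos_eq_iff]
        constructor
        · intro h
          exact ⟨(h 0 (by omega)).symm, fun i hi => h (i + 1) (by omega)⟩
        · rintro ⟨h0, h⟩ i hi
          cases i with
          | zero => exact h0.symm
          | succ i => exact h i (by omega)
      have hw0 : word (l + 1) r 0 = r.1 0 := rfl
      have hw0' : word (l + 2) s 0 = s.1 0 := rfl
      simp only [htail, hw0, hw0', consZero, hcons]
      have hr : r.1 0 = 0 ∨ r.1 0 = 1 := by omega
      by_cases hs : s.1 0 = 1 <;> rcases hr with hr | hr <;> simp [hs, hr]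
  · intro w' hw' hne
    rw [if_neg]
    rw [hiff _ (word_mem _ r) _ hw']
    exact fun h => hne h.2
  · intro w hw hne
    refine sum_eq_zero fun w' hw' => ?_
    rw [if_neg]
    rw [hiff _ hw _ hw']
    exact fun h => hne h.1

theorem lift_Aadd (l : ℕ) (x : Fin (mW (l + 1)) → ℤ) :
    lift (l + 2) (Aadd (l + 1) x) = dyckOp (lift (l + 1) x) := by
  funext s
  have h : ∀ j : Fin (mW (l + 1)), AMat (l + 1) (pos (l + 2) s) j =
      (if pos (l + 1) (shift s) = j then 1 else 0) +
      ((if pos (l + 1) (consZero s) = j then 1 else 0) +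
        if h : s.1 0 = 1 then 0 else
          if pos (l + 1) (cons 1 s (fun h' => h h'.2)) = j then 1 else 0) -
      if pos (l + 1) s = j then 1 else 0 := by
    intro j
    obtain ⟨r, rfl⟩ := pos_surjective (l + 1) j
    rw [AMat, AmatN, Mmat_pos, Imat_pos]
  change ∑ j, AMat (l + 1) (pos (l + 2) s) j * x j = _
  rw [dyckOp_apply, transfer]
  simp only [h, lift_apply, add_mul, sub_mul, sum_add_distrib, sum_sub_distrib, ite_mul, one_mul,
    zero_mul, sum_ite_eq, mem_univ, if_true]
  by_cases hs : s.1 0 = 1 <;> simp [hs]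

theorem mem_range_Aadd_iff {l : ℕ} {y : Fin (mW (l + 2)) → ℤ} :
    y ∈ (Aadd (l + 1)).range ↔ ∃ g, DependsOnPrefix (l + 1) g ∧ lift (l + 2) y = dyckOp g := by
  constructor
  · rintro ⟨x, rfl⟩
    exact ⟨_, dependsOnPrefix_lift _ x, lift_Aadd l x⟩
  · rintro ⟨g, hg, h⟩
    obtain ⟨x, rfl⟩ := exists_lift_eq hg
    exact ⟨x, lift_injective _ (by rw [lift_Aadd, h])⟩

theorem Hadd_apply (l : ℕ) (x : Fin (mW l) → ℤ) (i : Fin (mW (l + 1))) :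
    Hadd l x i = if h : (i : ℕ) < mW l then
      (if (i : ℕ) + 1 < mW l then x ⟨i, h⟩ else 2 * x ⟨i, h⟩)
      else -x ⟨mW l - 1, Nat.sub_lt (mW_pos l) Nat.one_pos⟩ := by
  change ∑ j : Fin (mW l), Hmat l ((i : ℕ) + 1) ((j : ℕ) + 1) * x j = _
  have hi := i.2
  split_ifs with h h'
  · rw [sum_eq_single ⟨i, h⟩]
    · simp [Hmat, h', Nat.succ_le_of_lt hi, Nat.succ_le_of_lt h]
    · intro j _ hj
      have hj' : (i : ℕ) ≠ j := fun h => hj (Fin.ext h.symm)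
      simp [Hmat, hj', show ¬ mW l < (i : ℕ) + 1 by omega]
    · simp
  · rw [sum_eq_single ⟨i, h⟩]
    · simp [Hmat, show (i : ℕ) + 1 = mW l by omega, mW_le_succ, (mW_pos l).ne']
    · intro j _ hj
      have hj' : (i : ℕ) ≠ j := fun h => hj (Fin.ext h.symm)
      simp [Hmat, hj', show ¬ mW l < (i : ℕ) + 1 by omega]
    · simp
  · have hm := mW_pos l
    rw [sum_eq_single ⟨mW l - 1, Nat.sub_lt (mW_pos l) Nat.one_pos⟩]
    · have h1 : mW l - 1 + 1 = mW l := by omega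
      simp [Hmat, h1, show (i : ℕ) + 1 ≠ mW l by omega, show mW l < (i : ℕ) + 1 by omega,
        Nat.succ_le_of_lt hi]
      omega
    · intro j _ hj
      have hj' : (j : ℕ) ≠ mW l - 1 := fun h => hj (Fin.ext h)
      have := j.2
      simp [Hmat, show (j : ℕ) + 1 ≠ mW l by omega, show (i : ℕ) ≠ j by omega]
    · simp

theorem mem_range_Hadd_iff {l : ℕ} {y : Fin (mW (l + 1)) → ℤ} :
    y ∈ (Hadd l).range ↔ ∃ c, lift (l + 1) y alternating = 2 * c ∧
      ∀ s : GoldenSeq, s.1 0 = 1 → lift (l + 1) y s = -c := by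
  have hm := mW_pos l
  have hle := mW_le_succ l
  constructor
  · rintro ⟨x, rfl⟩
    refine ⟨x ⟨mW l - 1, Nat.sub_lt (mW_pos l) Nat.one_pos⟩, ?_, fun s hs => ?_⟩
    · simp [Hadd_apply, pos_alternating, hm, show ¬ (mW l - 1 + 1 < mW l) by omega]
    · have : ¬ (pos (l + 1) s : ℕ) < mW l := by
        rw [pos_lt_iff]
        simp [hs]
      simp [Hadd_apply, this]
  · rintro ⟨c, hc, h⟩
    refine ⟨fun i => if (i : ℕ) + 1 < mW l then y ⟨i, i.2.trans_le hle⟩ else c, ?_⟩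
    funext i
    obtain ⟨s, rfl⟩ := pos_surjective _ i
    rw [Hadd_apply]
    split_ifs with h1 h2 h3
    · rfl
    · rw [← hc]
      refine congrArg y (Fin.ext ?_)
      rw [pos_alternating]
      omega
    · exact absurd h3 (by simp only; omega)
    · rw [pos_lt_iff] at h1
      exact (h s (by omega)).symm

end GoldenSeq

/-! ### The comparison isomorphism -/

open GoldenSeq

/-- The map on vectors inducing the isomorphism from the cokernel of `ℍ` to that of `𝔸`. -/
def compareAdd (n : ℕ) : (Fin (mW (n + 2)) → ℤ) →+ (Fin (mW (n + 2)) → ℤ) where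
  toFun y := (exists_lift_eq (dependsOnPrefix_lift (n + 2) y).compareOp).choose
  map_zero' := lift_injective _ <| by
    rw [(exists_lift_eq (dependsOnPrefix_lift (n + 2) _).compareOp).choose_spec]
    simp only [map_zero]
  map_add' x y := lift_injective _ <| by
    rw [(exists_lift_eq (dependsOnPrefix_lift (n + 2) (x + y)).compareOp).choose_spec,
      map_add (lift _) (Exists.choose _), (exists_lift_eq (dependsOnPrefix_lift (n + 2) x).compareOp).choose_spec,
      (exists_lift_eq (dependsOnPrefix_lift (n + 2) y).compareOp).choose_spec, map_add, map_add]

theorem lift_compareAdd (n : ℕ) (y : Fin (mW (n + 2)) → ℤ) :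
    lift (n + 2) (compareAdd n y) = compareOp (lift (n + 2) y) :=
  (exists_lift_eq (dependsOnPrefix_lift (n + 2) y).compareOp).choose_spec

theorem compareAdd_mem_range_iff {n : ℕ} {y : Fin (mW (n + 2)) → ℤ} :
    compareAdd n y ∈ (Aadd (n + 1)).range ↔ y ∈ (Hadd (n + 1)).range := by
  rw [mem_range_Aadd_iff, mem_range_Hadd_iff, lift_compareAdd]
  constructor
  · rintro ⟨g, hg, h⟩
    exact eq_const_of_compareOp_eq hg h
  · rintro ⟨c, h0, h1⟩
    exact ⟨_, fun _ _ _ => rfl, compareOp_eq_dyckOp_const h0 h1⟩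

theorem compareAdd_ITadd (n : ℕ) (y : Fin (mW (n + 2)) → ℤ) :
    compareAdd (n + 1) (ITadd (n + 2) y) = ITadd (n + 2) (compareAdd n y) :=
  lift_injective _ <| by rw [lift_compareAdd, lift_ITadd, lift_ITadd, lift_compareAdd]

theorem ITadd_mem_range_Aadd {n : ℕ} {y : Fin (mW (n + 2)) → ℤ}
    (hy : y ∈ (Aadd (n + 1)).range) : ITadd (n + 2) y ∈ (Aadd (n + 2)).range := by
  rw [mem_range_Aadd_iff] at hy ⊢
  obtain ⟨g, hg, h⟩ := hy
  exact ⟨g, hg.mono (Nat.le_succ _), by rw [lift_ITadd, h]⟩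

theorem exists_sub_compareAdd_mem (n : ℕ) (y : Fin (mW (n + 2)) → ℤ) :
    ∃ z, y - compareAdd n z ∈ (Aadd (n + 1)).range := by
  obtain ⟨g, x, hg, hx, h⟩ := exists_compareOp_add_dyckOp (n + 1) _ (dependsOnPrefix_lift _ y)
  obtain ⟨z, rfl⟩ := exists_lift_eq hg
  refine ⟨z, mem_range_Aadd_iff.2 ⟨x, hx, ?_⟩⟩
  rw [map_sub, lift_compareAdd, h, add_sub_cancel_left]

/-- The homomorphism of cokernels induced by `compareAdd`. -/
def cokerMap (n : ℕ) : ((Fin (mW (n + 2)) → ℤ) ⧸ (Hadd (n + 1)).range) →+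
    ((Fin (mW (n + 2)) → ℤ) ⧸ (Aadd (n + 1)).range) :=
  QuotientAddGroup.map _ _ (compareAdd n) fun _ hy => compareAdd_mem_range_iff.2 hy

theorem cokerMap_bijective (n : ℕ) : Function.Bijective (cokerMap n) := by
  constructor
  · rw [injective_iff_map_eq_zero]
    intro q
    obtain ⟨y, rfl⟩ := QuotientAddGroup.mk'_surjective _ q
    intro h
    exact (QuotientAddGroup.eq_zero_iff _).2
      (compareAdd_mem_range_iff.1 ((QuotientAddGroup.eq_zero_iff _).1 h))
  · intro q
    obtain ⟨y, rfl⟩ := QuotientAddGroup.mk'_surjective _ q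
    obtain ⟨z, hz⟩ := exists_sub_compareAdd_mem n y
    refine ⟨QuotientAddGroup.mk' _ z, ?_⟩
    exact (QuotientAddGroup.eq_iff_sub_mem.2 hz).symm

/-- The isomorphism from the cokernel of `ℍ` to that of `𝔸`. -/
def cokerEquiv (n : ℕ) : ((Fin (mW (n + 2)) → ℤ) ⧸ (Hadd (n + 1)).range) ≃+
    ((Fin (mW (n + 2)) → ℤ) ⧸ (Aadd (n + 1)).range) :=
  AddEquiv.ofBijective (cokerMap n) (cokerMap_bijective n)

theorem cokerEquiv_mk (n : ℕ) (y : Fin (mW (n + 2)) → ℤ) :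
    cokerEquiv n (QuotientAddGroup.mk' _ y) = QuotientAddGroup.mk' _ (compareAdd n y) := rfl

theorem cokerEquiv_symm_ITadd (n : ℕ) (x y : Fin (mW (n + 2)) → ℤ)
    (h : (cokerEquiv n).symm (QuotientAddGroup.mk' (Aadd (n + 1)).range x) =
      QuotientAddGroup.mk' (Hadd (n + 1)).range y) :
    (cokerEquiv (n + 1)).symm (QuotientAddGroup.mk' (Aadd (n + 2)).range (ITadd (n + 2) x)) =
      QuotientAddGroup.mk' (Hadd (n + 2)).range (ITadd (n + 2) y) := by
  rw [AddEquiv.symm_apply_eq] at h ⊢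
  rw [cokerEquiv_mk] at h ⊢
  rw [compareAdd_ITadd]
  have h' := ITadd_mem_range_Aadd (QuotientAddGroup.eq_iff_sub_mem.1 h)
  rw [map_sub] at h'
  exact QuotientAddGroup.eq_iff_sub_mem.2 h'

/-! ### Inductive limits -/

/-- Two inductive limits of the same sequence of groups are isomorphic. -/
theorem nonempty_addEquiv_of_directLimits {G : ℕ → Type*} [∀ n, AddCommGroup (G n)]
    {S T : Type*} [AddCommGroup S] [AddCommGroup T]
    (φ : ∀ n, G n →+ S) (ψ : ∀ n, G n →+ T)
    (hstep : ∀ n q, ∃ q', φ (n + 1) q' = φ n q ∧ ψ (n + 1) q' = ψ n q)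
    (hφ : ∀ t, ∃ n q, φ n q = t) (hψ : ∀ t, ∃ n q, ψ n q = t)
    (hker : ∀ n q, φ n q = 0 ↔ ψ n q = 0) : Nonempty (S ≃+ T) := by
  have push : ∀ n N, n ≤ N → ∀ q, ∃ q', φ N q' = φ n q ∧ ψ N q' = ψ n q := by
    intro n N hN q
    induction N, hN using Nat.le_induction with
    | base => exact ⟨q, rfl, rfl⟩
    | succ N _ ih =>
      obtain ⟨q', h1, h2⟩ := ih
      obtain ⟨q'', h3, h4⟩ := hstep N q'
      exact ⟨q'', h3.trans h1, h4.trans h2⟩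
  have common : ∀ n m q r, ∃ N q' r', (φ N q' = φ n q ∧ ψ N q' = ψ n q) ∧
      (φ N r' = φ m r ∧ ψ N r' = ψ m r) := by
    intro n m q r
    obtain ⟨q', hq⟩ := push n (max n m) (le_max_left _ _) q
    obtain ⟨r', hr⟩ := push m (max n m) (le_max_right _ _) r
    exact ⟨_, q', r', hq, hr⟩
  have heq : ∀ n m q r, φ n q = φ m r ↔ ψ n q = ψ m r := by
    intro n m q r
    obtain ⟨N, q', r', ⟨h1, h2⟩, h3, h4⟩ := common n m q r
    rw [← h1, ← h2, ← h3, ← h4, ← sub_eq_zero, ← map_sub, hker, map_sub, sub_eq_zero]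
  choose a b hab using hφ
  have hval : ∀ n q, ψ (a (φ n q)) (b (φ n q)) = ψ n q := fun n q =>
    (heq _ _ _ _).1 (hab (φ n q))
  let f : S →+ T := AddMonoidHom.mk' (fun t => ψ (a t) (b t)) <| by
    intro s t
    obtain ⟨N, q', r', ⟨h1, h2⟩, h3, h4⟩ := common (a s) (a t) (b s) (b t)
    have : s + t = φ N (q' + r') := by rw [map_add, h1, h3, hab, hab]
    rw [this, hval, map_add, h2, h4]
  refine ⟨AddEquiv.ofBijective f ⟨fun s t h => ?_, fun t => ?_⟩⟩
  · have h' : φ (a s) (b s) = φ (a t) (b t) := (heq _ _ _ _).2 h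
    rwa [hab, hab] at h'
  · obtain ⟨n, q, rfl⟩ := hψ t
    exact ⟨φ n q, hval n q⟩

theorem ITreach.eq_of_compatible {T : Type*} (φ : ∀ a, (Fin (mW a) → ℤ) → T)
    (hφ : ∀ n x, φ (n + 3) (ITadd (n + 2) x) = φ (n + 2) x) {a b : ℕ}
    {x : Fin (mW a) → ℤ} {y : Fin (mW b) → ℤ} (h : ITreach a b x y) (ha : 2 ≤ a) :
    2 ≤ b ∧ φ b y = φ a x := by
  induction h with
  | refl => exact ⟨ha, rfl⟩
  | @step b x y _ ih =>
    obtain ⟨hb, h⟩ := ih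
    obtain ⟨n, rfl⟩ := Nat.exists_eq_add_of_le' hb
    exact ⟨by omega, (hφ n y).trans h⟩

/-- If a class eventually vanishes, it is killed by every compatible family of maps. -/
theorem eq_zero_of_ITreach {T : Type*} [Zero T]
    (φ : ∀ n, (Fin (mW (n + 2)) → ℤ) → T)
    (hφ : ∀ n x, φ (n + 1) (ITadd (n + 2) x) = φ n x) {n b : ℕ}
    {x : Fin (mW (n + 2)) → ℤ} {y : Fin (mW (b + 2)) → ℤ} (h : ITreach (n + 2) (b + 2) x y)
    (hy : φ b y = 0) : φ n x = 0 := by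
  let φ' : ∀ a, (Fin (mW a) → ℤ) → T := fun a => match a with
    | 0 => fun _ => 0
    | 1 => fun _ => 0
    | n + 2 => φ n
  exact (h.eq_of_compatible φ' hφ (by omega)).2.symm.trans hy

/-- Compatible isomorphisms between quotients of the groups `ℤ^{m(l)}` induce an isomorphism of
the inductive limits along the maps `I^t_{l,l+1}`. -/
theorem nonempty_addEquiv_of_quotient_equivs (R S : ∀ n, AddSubgroup (Fin (mW (n + 2)) → ℤ))
    (η : ∀ n, ((Fin (mW (n + 2)) → ℤ) ⧸ R n) ≃+ ((Fin (mW (n + 2)) → ℤ) ⧸ S n))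
    (hη : ∀ (n : ℕ) (x y : Fin (mW (n + 2)) → ℤ),
      η n (QuotientAddGroup.mk' (R n) x) = QuotientAddGroup.mk' (S n) y →
        η (n + 1) (QuotientAddGroup.mk' (R (n + 1)) (ITadd (n + 2) x)) =
          QuotientAddGroup.mk' (S (n + 1)) (ITadd (n + 2) y))
    {TA TH : Type*} [AddCommGroup TA] [AddCommGroup TH]
    (θA : ∀ n, ((Fin (mW (n + 2)) → ℤ) ⧸ R n) →+ TA)
    (θH : ∀ n, ((Fin (mW (n + 2)) → ℤ) ⧸ S n) →+ TH)
    (hA : ∀ (n : ℕ) (x : Fin (mW (n + 2)) → ℤ),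
      θA (n + 1) (QuotientAddGroup.mk' (R (n + 1)) (ITadd (n + 2) x)) =
        θA n (QuotientAddGroup.mk' (R n) x))
    (hAs : ∀ t : TA, ∃ (n : ℕ) (x : Fin (mW (n + 2)) → ℤ),
      θA n (QuotientAddGroup.mk' (R n) x) = t)
    (hAk : ∀ (n : ℕ) (x : Fin (mW (n + 2)) → ℤ), θA n (QuotientAddGroup.mk' (R n) x) = 0 →
      ∃ (b : ℕ) (y : Fin (mW (b + 2)) → ℤ), ITreach (n + 2) (b + 2) x y ∧ y ∈ R b)
    (hH : ∀ (n : ℕ) (x : Fin (mW (n + 2)) → ℤ),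
      θH (n + 1) (QuotientAddGroup.mk' (S (n + 1)) (ITadd (n + 2) x)) =
        θH n (QuotientAddGroup.mk' (S n) x))
    (hHs : ∀ t : TH, ∃ (n : ℕ) (x : Fin (mW (n + 2)) → ℤ),
      θH n (QuotientAddGroup.mk' (S n) x) = t)
    (hHk : ∀ (n : ℕ) (x : Fin (mW (n + 2)) → ℤ), θH n (QuotientAddGroup.mk' (S n) x) = 0 →
      ∃ (b : ℕ) (y : Fin (mW (b + 2)) → ℤ), ITreach (n + 2) (b + 2) x y ∧ y ∈ S b) :
    Nonempty (TA ≃+ TH) := by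
  have hH' : ∀ (n : ℕ) (x : Fin (mW (n + 2)) → ℤ),
      θH (n + 1) (η (n + 1) (QuotientAddGroup.mk' _ (ITadd (n + 2) x))) =
        θH n (η n (QuotientAddGroup.mk' _ x)) := by
    intro n x
    obtain ⟨y, hy⟩ := QuotientAddGroup.mk'_surjective _ (η n (QuotientAddGroup.mk' _ x))
    rw [hη n x y hy.symm, hH, hy]
  have hA' : ∀ (n : ℕ) (y : Fin (mW (n + 2)) → ℤ),
      θA (n + 1) ((η (n + 1)).symm (QuotientAddGroup.mk' _ (ITadd (n + 2) y))) =
        θA n ((η n).symm (QuotientAddGroup.mk' _ y)) := by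
    intro n y
    obtain ⟨x, hx⟩ := QuotientAddGroup.mk'_surjective _ ((η n).symm (QuotientAddGroup.mk' _ y))
    have h := hη n x y (by rw [hx, AddEquiv.apply_symm_apply])
    rw [← h, AddEquiv.symm_apply_apply, hA, hx]
  refine nonempty_addEquiv_of_directLimits θA
    (fun n => (θH n).comp (η n).toAddMonoidHom) ?_ ?_ ?_ ?_
  · intro n q
    obtain ⟨x, rfl⟩ := QuotientAddGroup.mk'_surjective _ q
    exact ⟨QuotientAddGroup.mk' _ (ITadd (n + 2) x), hA n x, hH' n x⟩
  · intro t
    obtain ⟨n, x, h⟩ := hAs t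
    exact ⟨n, _, h⟩
  · intro t
    obtain ⟨n, y, h⟩ := hHs t
    refine ⟨n, (η n).symm (QuotientAddGroup.mk' _ y), ?_⟩
    change θH n (η n ((η n).symm _)) = t
    rw [AddEquiv.apply_symm_apply, h]
  · intro n q
    constructor
    · intro h
      obtain ⟨x, rfl⟩ := QuotientAddGroup.mk'_surjective _ q
      obtain ⟨b, y, hr, hy⟩ := hAk n x h
      refine eq_zero_of_ITreach (fun n x => θH n (η n (QuotientAddGroup.mk' (R n) x))) hH' hr ?_
      have : QuotientAddGroup.mk' (R b) y = 0 := (QuotientAddGroup.eq_zero_iff _).2 hy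
      simp only [this, map_zero]
    · intro h
      obtain ⟨q, rfl⟩ := (η n).symm.surjective q
      obtain ⟨y, rfl⟩ := QuotientAddGroup.mk'_surjective _ q
      change θH n (η n ((η n).symm _)) = 0 at h
      rw [AddEquiv.apply_symm_apply] at h
      obtain ⟨b, z, hr, hz⟩ := hHk n y h
      refine eq_zero_of_ITreach
        (fun n y => θA n ((η n).symm (QuotientAddGroup.mk' (S n) y))) hA' hr ?_
      have : QuotientAddGroup.mk' (S b) z = 0 := (QuotientAddGroup.eq_zero_iff _).2 hz
      simp only [this, map_zero]

/-- there are group isomorphisms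
`η_l : ℤ^{m(l)}/𝔸_{l,l-1}ℤ^{m(l-1)} → ℤ^{m(l)}/ℍ_{l,l-1}ℤ^{m(l-1)}` (for `l ≥ 2`, here
`l = n + 2`, so `𝔸_{l,l-1} = Aadd (n+1)` and `ℍ_{l,l-1} = Hadd (n+1)`) commuting with the
maps induced by `I_{l,l+1}^t` (stated on representatives, which also expresses that the
induced maps are well defined); consequently any direct limit of the first system is
isomorphic to any direct limit of the second system (direct limits being characterized by
a compatible, jointly surjective family of maps whose kernels are the eventually
vanishing classes). -/
theorem coker_A_iso_coker_H :
    ∃ η : ∀ n : ℕ,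
        ((Fin (mW (n + 2)) → ℤ) ⧸ (Aadd (n + 1)).range) ≃+
          ((Fin (mW (n + 2)) → ℤ) ⧸ (Hadd (n + 1)).range),
      (∀ (n : ℕ) (x y : Fin (mW (n + 2)) → ℤ),
          η n (QuotientAddGroup.mk' (Aadd (n + 1)).range x) =
            QuotientAddGroup.mk' (Hadd (n + 1)).range y →
          η (n + 1) (QuotientAddGroup.mk' (Aadd (n + 2)).range (ITadd (n + 2) x)) =
            QuotientAddGroup.mk' (Hadd (n + 2)).range (ITadd (n + 2) y))
      ∧
      (∀ (TA : Type) [AddCommGroup TA]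
          (θA : ∀ n : ℕ, ((Fin (mW (n + 2)) → ℤ) ⧸ (Aadd (n + 1)).range) →+ TA)
          (TH : Type) [AddCommGroup TH]
          (θH : ∀ n : ℕ, ((Fin (mW (n + 2)) → ℤ) ⧸ (Hadd (n + 1)).range) →+ TH),
        -- `θA` presents `TA` as the inductive limit of the system `𝔸`:
        (∀ (n : ℕ) (x : Fin (mW (n + 2)) → ℤ),
            θA (n + 1) (QuotientAddGroup.mk' (Aadd (n + 2)).range (ITadd (n + 2) x)) =
              θA n (QuotientAddGroup.mk' (Aadd (n + 1)).range x)) →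
        (∀ t : TA, ∃ (n : ℕ) (x : Fin (mW (n + 2)) → ℤ),
            θA n (QuotientAddGroup.mk' (Aadd (n + 1)).range x) = t) →
        (∀ (n : ℕ) (x : Fin (mW (n + 2)) → ℤ),
            θA n (QuotientAddGroup.mk' (Aadd (n + 1)).range x) = 0 →
            ∃ (b : ℕ) (y : Fin (mW (b + 2)) → ℤ),
              ITreach (n + 2) (b + 2) x y ∧ y ∈ (Aadd (b + 1)).range) →
        -- `θH` presents `TH` as the inductive limit of the system `ℍ`:
        (∀ (n : ℕ) (x : Fin (mW (n + 2)) → ℤ),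
            θH (n + 1) (QuotientAddGroup.mk' (Hadd (n + 2)).range (ITadd (n + 2) x)) =
              θH n (QuotientAddGroup.mk' (Hadd (n + 1)).range x)) →
        (∀ t : TH, ∃ (n : ℕ) (x : Fin (mW (n + 2)) → ℤ),
            θH n (QuotientAddGroup.mk' (Hadd (n + 1)).range x) = t) →
        (∀ (n : ℕ) (x : Fin (mW (n + 2)) → ℤ),
            θH n (QuotientAddGroup.mk' (Hadd (n + 1)).range x) = 0 →
            ∃ (b : ℕ) (y : Fin (mW (b + 2)) → ℤ),
              ITreach (n + 2) (b + 2) x y ∧ y ∈ (Hadd (b + 1)).range) →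
        Nonempty (TA ≃+ TH)) := by
  refine ⟨fun n => (cokerEquiv n).symm, cokerEquiv_symm_ITadd, ?_⟩
  intro TA _ θA TH _ θH
  exact nonempty_addEquiv_of_quotient_equivs (fun n => (Aadd (n + 1)).range)
    (fun n => (Hadd (n + 1)).range) (fun n => (cokerEquiv n).symm) cokerEquiv_symm_ITadd θA θH
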